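/- ((p,q)-Taylor formula, second form.) Let K be a field and p, q nonzero elements of K with p^j ≠ q^j for 1 ≤ j ≤ N, and let a ∈ K. Then every polynomial f ∈ K[X] of degree at most N satisfies the identity f = Σ_{k=0}^{N} (−1)^k q^{−k(k−1)/2} · ((D_{p,q}^k f)(a q^{−k}) / [k]!_{p,q}) · (a ⊖ X)^k_{p,q} in K[X], where (D_{p,q}^k f)(a q^{−k}) denotes the evaluation of the polynomial D_{p,q}^k f at the point a q^{−k}. -/

import Mathlib

open Polynomial

/-- The `(p,q)`-number `[n]_{p,q} = (pⁿ − qⁿ)/(p − q)`. -/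
noncomputable def pqNum {K : Type*} [Field K] (p q : K) (n : ℕ) : K :=
  (p ^ n - q ^ n) / (p - q)

/-- The `(p,q)`-factorial `[n]!_{p,q} = ∏_{j=1}^{n} [j]_{p,q}`. -/
noncomputable def pqFactorial {K : Type*} [Field K] (p q : K) (n : ℕ) : K :=
  ∏ j ∈ Finset.range n, pqNum p q (j + 1)

/-- The `(p,q)`-derivative on `K[X]`: the `K`-linear operation with
`D_{p,q}(Xⁿ) = [n]_{p,q} X^{n−1}` and `D_{p,q}(1) = 0`; equivalently, for `z ≠ 0`,
`(D_{p,q}f)(z) = (f(pz) − f(qz))/((p − q)z)`. -/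
noncomputable def pqDeriv {K : Type*} [Field K] (p q : K) (f : Polynomial K) : Polynomial K :=
  Polynomial.C (p - q)⁻¹ * (f.comp (Polynomial.C p * Polynomial.X) -
    f.comp (Polynomial.C q * Polynomial.X)).divX

section PQTaylor

variable {K : Type*} [Field K] (p q a : K)

theorem coeff_pqDeriv (f : K[X]) (n : ℕ) :
    (pqDeriv p q f).coeff n = pqNum p q (n + 1) * f.coeff (n + 1) := by
  simp only [pqDeriv, pqNum, coeff_C_mul, coeff_divX, coeff_sub, comp_C_mul_X_coeff]
  ring

/-- The `(p,q)`-derivative as a linear map. -/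
noncomputable def pqDerivLinear : K[X] →ₗ[K] K[X] where
  toFun := pqDeriv p q
  map_add' f g := by ext n; simp only [coeff_pqDeriv, coeff_add]; ring
  map_smul' c f := by
    ext n; simp only [coeff_pqDeriv, coeff_smul, smul_eq_mul, RingHom.id_apply]; ring

theorem pqDerivLinear_apply (f : K[X]) : pqDerivLinear p q f = pqDeriv p q f := rfl

theorem pqDeriv_C_mul (c : K) (f : K[X]) : pqDeriv p q (C c * f) = C c * pqDeriv p q f := by
  simpa only [smul_eq_C_mul, pqDerivLinear_apply] using (pqDerivLinear p q).map_smul c f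

theorem pqDeriv_sum {ι : Type*} (s : Finset ι) (f : ι → K[X]) :
    pqDeriv p q (∑ i ∈ s, f i) = ∑ i ∈ s, pqDeriv p q (f i) :=
  map_sum (pqDerivLinear p q) f s

theorem pqDeriv_C (c : K) : pqDeriv p q (C c) = 0 := by
  ext n; simp [coeff_pqDeriv, coeff_C_succ]

theorem natDegree_pqDeriv_le {f : K[X]} {N : ℕ} (hf : f.natDegree ≤ N + 1) :
    (pqDeriv p q f).natDegree ≤ N := by
  refine natDegree_le_iff_coeff_eq_zero.2 fun n hn => ?_
  rw [coeff_pqDeriv, coeff_eq_zero_of_natDegree_lt (by lia), mul_zero]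

variable {p q} in
theorem pqNum_ne_zero {n : ℕ} (h₁ : p ≠ q) (h : p ^ n ≠ q ^ n) : pqNum p q n ≠ 0 :=
  div_ne_zero (sub_ne_zero.2 h) (sub_ne_zero.2 h₁)

variable {p q a} in
/-- A polynomial is determined by its `(p,q)`-derivative and its value at one point. -/
theorem eq_of_pqDeriv_eq {f g : K[X]} {N : ℕ} (hf : f.natDegree ≤ N) (hg : g.natDegree ≤ N)
    (hN : ∀ n < N, pqNum p q (n + 1) ≠ 0) (hD : pqDeriv p q f = pqDeriv p q g)
    (ha : f.eval a = g.eval a) : f = g := by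
  have hcoeff (n : ℕ) : f.coeff (n + 1) = g.coeff (n + 1) := by
    by_cases hn : n < N
    · have h := congrArg (coeff · n) hD
      simp only [coeff_pqDeriv] at h
      exact mul_left_cancel₀ (hN n hn) h
    · rw [coeff_eq_zero_of_natDegree_lt (by lia), coeff_eq_zero_of_natDegree_lt (by lia)]
  have hdivX : f.divX = g.divX := by ext n; simp only [coeff_divX, hcoeff]
  rw [← divX_mul_X_add f, ← divX_mul_X_add g, hdivX] at ha ⊢
  simp only [eval_add, eval_C, add_right_inj] at ha
  rw [ha]

/-- The `(p,q)`-power basis polynomial `(a ⊖ X)ⁿ_{p,q}`. -/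
noncomputable def pqPow (n : ℕ) : K[X] :=
  ∏ i ∈ Finset.range n, (C (p ^ i * a) - C (q ^ i) * X)

theorem natDegree_pqPow_le (n : ℕ) : (pqPow p q a n).natDegree ≤ n := by
  refine (natDegree_prod_le _ _).trans ((Finset.sum_le_card_nsmul _ _ 1 fun i _ => ?_).trans ?_)
  · compute_degree
  · simp

theorem eval_pqPow_succ (n : ℕ) : (pqPow p q a (n + 1)).eval a = 0 := by
  simp [pqPow, Finset.prod_range_succ']

theorem pqPow_comp_C_mul_X (n : ℕ) :
    (pqPow p q a n).comp (C q * X) =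
      ∏ i ∈ Finset.range n, (C (p ^ i * a) - C (q ^ (i + 1)) * X) := by
  simp only [pqPow, prod_comp, sub_comp, mul_comp, C_comp, X_comp]
  refine Finset.prod_congr rfl fun i _ => ?_
  simp only [pow_succ, C_mul]
  ring

theorem pqDeriv_pqPow_succ (n : ℕ) :
    pqDeriv p q (pqPow p q a (n + 1)) =
      -C (pqNum p q (n + 1)) * (pqPow p q a n).comp (C q * X) := by
  have hq : (pqPow p q a (n + 1)).comp (C q * X) =
      (pqPow p q a n).comp (C q * X) * (C (p ^ n * a) - C (q ^ (n + 1)) * X) := by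
    simp only [pqPow_comp_C_mul_X, Finset.prod_range_succ]
  have hp : (pqPow p q a (n + 1)).comp (C p * X) =
      (pqPow p q a n).comp (C q * X) * (C (p ^ n * a) - C (p ^ (n + 1)) * X) := by
    rw [pqPow_comp_C_mul_X, pqPow, Finset.prod_range_succ', mul_comp, prod_comp]
    have hfac (i : ℕ) : (C (p ^ (i + 1) * a) - C (q ^ (i + 1)) * X).comp (C p * X) =
        C p * (C (p ^ i * a) - C (q ^ (i + 1)) * X) := by
      simp only [sub_comp, mul_comp, C_comp, X_comp, pow_succ, C_mul]
      ring
    simp only [hfac, Finset.prod_mul_distrib, Finset.prod_const, Finset.card_range]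
    simp only [sub_comp, mul_comp, C_comp, X_comp, pow_succ, C_mul, C_pow, pow_zero, C_1, one_comp]
    ring
  have hsub : (pqPow p q a (n + 1)).comp (C p * X) - (pqPow p q a (n + 1)).comp (C q * X) =
      -C (p ^ (n + 1) - q ^ (n + 1)) * (pqPow p q a n).comp (C q * X) * X := by
    rw [hp, hq, C_sub]
    ring
  have hdivX (g : K[X]) : (g * X).divX = g := by ext; simp
  rw [pqDeriv, hsub, hdivX, pqNum, div_eq_mul_inv, C_mul]
  ring

variable {p q} in
theorem pqPow_div (hq : q ≠ 0) (n : ℕ) :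
    pqPow p q (a / q) n = C (q ^ n)⁻¹ * (pqPow p q a n).comp (C q * X) := by
  have hfac (i : ℕ) : C (p ^ i * (a / q)) - C (q ^ i) * X =
      C q⁻¹ * (C (p ^ i * a) - C (q ^ (i + 1)) * X) := by
    have h : q ^ i = q⁻¹ * q ^ (i + 1) := by rw [pow_succ', inv_mul_cancel_left₀ hq]
    rw [mul_sub, ← mul_assoc, ← C_mul, ← C_mul, ← h, div_eq_mul_inv]
    congr 2
    ring
  rw [pqPow_comp_C_mul_X, pqPow]
  simp only [hfac, Finset.prod_mul_distrib, Finset.prod_const, Finset.card_range, ← C_pow, inv_pow]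

/-- The coefficient of `(a ⊖ X)ᵏ_{p,q}` in the second `(p,q)`-Taylor expansion of `f`. -/
noncomputable def pqTaylorCoeff (f : K[X]) (k : ℕ) : K :=
  (-1) ^ k * (q ^ (k * (k - 1) / 2))⁻¹ *
    (((pqDeriv p q)^[k] f).eval (a / q ^ k) / pqFactorial p q k)

variable {p q} in
theorem pqTaylorCoeff_succ (f : K[X]) (k : ℕ) (hk : pqNum p q (k + 1) ≠ 0) :
    pqTaylorCoeff p q a f (k + 1) * -pqNum p q (k + 1) =
      pqTaylorCoeff p q (a / q) (pqDeriv p q f) k * (q ^ k)⁻¹ := by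
  have hexp : (k + 1) * (k + 1 - 1) / 2 = k * (k - 1) / 2 + k := by
    rw [← Nat.choose_two_right, ← Nat.choose_two_right, Nat.choose_succ_succ' k 1,
      Nat.choose_one_right, add_comm]
  have hfac : pqFactorial p q (k + 1) = pqFactorial p q k * pqNum p q (k + 1) :=
    Finset.prod_range_succ _ _
  rw [pqTaylorCoeff, pqTaylorCoeff, hexp, hfac, Function.iterate_succ_apply, div_div a,
    ← pow_succ', pow_add q, mul_inv, ← div_div]
  field_simp
  ring

variable {p q} in
theorem pqTaylor_expansion (hq : q ≠ 0) (N : ℕ) (hpq : ∀ n < N, pqNum p q (n + 1) ≠ 0)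
    (f : K[X]) (hf : f.natDegree ≤ N) :
    f = ∑ k ∈ Finset.range (N + 1), C (pqTaylorCoeff p q a f k) * pqPow p q a k := by
  induction N generalizing a f with
  | zero =>
    rw [eq_C_of_natDegree_le_zero hf]
    simp [pqTaylorCoeff, pqPow, pqFactorial]
  | succ N ih =>
    refine eq_of_pqDeriv_eq (a := a) hf ?_ hpq ?_ ?_
    · refine natDegree_sum_le_of_forall_le _ _ fun k hk => ?_
      have := Finset.mem_range.1 hk
      exact (natDegree_C_mul_le _ _).trans ((natDegree_pqPow_le p q a k).trans (by lia))
    · rw [ih (a / q) (fun n hn => hpq n (by lia)) _ (natDegree_pqDeriv_le p q hf), pqDeriv_sum,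
        Finset.sum_range_succ' _ (N + 1)]
      have h0 : pqDeriv p q (C (pqTaylorCoeff p q a f 0) * pqPow p q a 0) = 0 := by
        simp [pqPow, pqDeriv_C]
      rw [h0, add_zero]
      refine Finset.sum_congr rfl fun k hk => ?_
      rw [pqDeriv_C_mul, pqDeriv_pqPow_succ, pqPow_div a hq, ← C_neg, ← mul_assoc, ← mul_assoc,
        ← C_mul, ← C_mul, pqTaylorCoeff_succ a f k (hpq k (Finset.mem_range.1 hk))]
    · rw [eval_finsetSum, Finset.sum_range_succ']
      simp only [eval_mul, eval_pqPow_succ, mul_zero, Finset.sum_const_zero, zero_add]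
      simp [pqTaylorCoeff, pqPow, pqFactorial]

end PQTaylor

/-- The `(p,q)`-Taylor formula, second form: every polynomial `f` of degree at most `N`
satisfies
`f = Σ_{k=0}^{N} (−1)^k q^{−k(k−1)/2} ((D_{p,q}^k f)(a q^{−k}) / [k]!_{p,q}) (a ⊖ X)^k_{p,q}`,
where `(a ⊖ x)^k_{p,q} = ∏_{i=0}^{k−1} (pⁱ a − qⁱ x)`. -/
theorem pq_taylor_formula_second_form
    (K : Type*) [Field K] (p q : K) (hp : p ≠ 0) (hq : q ≠ 0) (N : ℕ)
    (hpq : ∀ j : ℕ, 1 ≤ j → j ≤ N → p ^ j ≠ q ^ j) (a : K)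
    (f : Polynomial K) (hf : f.natDegree ≤ N) :
    f = ∑ k ∈ Finset.range (N + 1),
        C ((-1) ^ k * (q ^ (k * (k - 1) / 2))⁻¹ *
            (((pqDeriv p q)^[k] f).eval (a / q ^ k) / pqFactorial p q k)) *
          ∏ i ∈ Finset.range k, (C (p ^ i * a) - C (q ^ i) * X) := by
  refine pqTaylor_expansion a hq N (fun n hn => pqNum_ne_zero ?_ (hpq (n + 1) (by lia) hn)) f hf
  simpa using hpq 1 le_rfl (by lia)
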